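/- Let f and ν be a frontal with unit normal near p = (0,0) as in the context, with f_u(0,0) = 0 and f_uu(0,0) ≠ 0. Set γ̂(u) := f(u,0) and let σ(u) := γ̂(u) − ⟨γ̂(u) − γ̂(0), ν(0,0)⟩·ν(0,0) be the orthogonal projection of γ̂ to the tangential plane at f(p) (the plane through f(p) orthogonal to ν(p)). Then ⟨f_uu(0,0), ν(0,0)⟩ = 0, ‖σ''(0)‖ = ‖γ̂''(0)‖, and |det(σ''(0), σ'''(0), ν(0,0))| / ‖σ''(0)‖^{5/2} = |det(γ̂''(0), γ̂'''(0), ν(0,0))| / ‖γ̂''(0)‖^{5/2}; that is, the limiting singular curvature τ_s coincides with the absolute value of the cuspidal curvature of the projected curve σ in the tangential plane. -/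

import Mathlib

open scoped RealInnerProductSpace
open Filter

noncomputable section

/-- Euclidean 3-space. -/
abbrev E3 : Type := EuclideanSpace ℝ (Fin 3)

/-- Partial derivative in the first (`u`) direction. -/
def pu {E : Type*} [NormedAddCommGroup E] [NormedSpace ℝ E] (f : ℝ × ℝ → E) (q : ℝ × ℝ) : E :=
  fderiv ℝ f q (1, 0)

/-- Partial derivative in the second (`v`) direction. -/
def pv {E : Type*} [NormedAddCommGroup E] [NormedSpace ℝ E] (f : ℝ × ℝ → E) (q : ℝ × ℝ) : E :=
  fderiv ℝ f q (0, 1)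

/-- Determinant of three column vectors in `ℝ³`. -/
def det3 (a b c : E3) : ℝ :=
  Matrix.det !![a 0, b 0, c 0; a 1, b 1, c 1; a 2, b 2, c 2]

/-- Cross product in `ℝ³`. -/
def cross3 (a b : E3) : E3 :=
  (WithLp.equiv 2 (Fin 3 → ℝ)).symm
    ![a 1 * b 2 - a 2 * b 1, a 2 * b 0 - a 0 * b 2, a 0 * b 1 - a 1 * b 0]

/-- Subtracting multiples of the third column from the first two does not change `det3`. -/
theorem det3_sub_smul_right (a b c : E3) (s t : ℝ) :
    det3 (a - s • c) (b - t • c) c = det3 a b c := by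
  simp only [det3, Matrix.det_fin_three, Matrix.of_apply, Matrix.cons_val, PiLp.sub_apply,
    PiLp.smul_apply, smul_eq_mul]
  ring

/-- The derivative of the projection of a curve is the projection of the derivative. -/
theorem deriv_sub_inner_smul {E : Type*} [NormedAddCommGroup E] [InnerProductSpace ℝ E]
    {g : ℝ → E} (hg : Differentiable ℝ g) (c n : E) :
    deriv (fun u => g u - ⟪g u - c, n⟫ • n) = fun u => deriv g u - ⟪deriv g u, n⟫ • n := by
  funext u
  have h := (hg u).hasDerivAt
  have hi : HasDerivAt (fun u => ⟪g u - c, n⟫) ⟪deriv g u, n⟫ u := by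
    simpa using (h.sub_const c).inner ℝ (hasDerivAt_const u n)
  exact (h.sub (hi.smul_const n)).deriv

/-- The derivative of a map along the `u`-axis is its partial derivative `pu`. -/
theorem hasDerivAt_comp_mk_zero {E : Type*} [NormedAddCommGroup E] [NormedSpace ℝ E]
    {g : ℝ × ℝ → E} (hg : Differentiable ℝ g) (u : ℝ) :
    HasDerivAt (fun u => g (u, 0)) (pu g (u, 0)) u :=
  (hg (u, 0)).hasFDerivAt.comp_hasDerivAt u ((hasDerivAt_id u).prodMk (hasDerivAt_const u 0))

theorem contDiff_pu {E : Type*} [NormedAddCommGroup E] [NormedSpace ℝ E]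
    {g : ℝ × ℝ → E} (hg : ContDiff ℝ (⊤ : ℕ∞) g) : ContDiff ℝ (⊤ : ℕ∞) (pu g) :=
  (hg.fderiv_right (m := (⊤ : ℕ∞)) (by simp)).clm_apply contDiff_const

theorem deriv_comp_mk_zero {E : Type*} [NormedAddCommGroup E] [NormedSpace ℝ E]
    {g : ℝ × ℝ → E} (hg : ContDiff ℝ (⊤ : ℕ∞) g) :
    deriv (fun u => g (u, 0)) = fun u => pu g (u, 0) :=
  funext fun u => (hasDerivAt_comp_mk_zero (hg.differentiable (by simp)) u).deriv

/-- The limiting singular curvature at a swallowtail coincides with the cuspidal curvature of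
the orthogonal projection `σ` of `γ̂ = f(·,0)` to the tangential plane at `f(p)`:
`⟨f_uu, ν⟩(0,0) = 0`, `‖σ''(0)‖ = ‖γ̂''(0)‖`, and the cuspidal curvature expressions of `σ`
and `γ̂` agree. -/
theorem limiting_singular_curvature_eq_projected_cuspidal_curvature
    (f ν : ℝ × ℝ → E3)
    (hf : ContDiff ℝ (⊤ : ℕ∞) f) (hν : ContDiff ℝ (⊤ : ℕ∞) ν)
    (hfrontal : ∀ᶠ q in nhds ((0, 0) : ℝ × ℝ),
      ‖ν q‖ = 1 ∧ ⟪ν q, pu f q⟫ = 0 ∧ ⟪ν q, pv f q⟫ = 0)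
    (hfu0 : pu f (0, 0) = 0) (hfuu : pu (pu f) (0, 0) ≠ 0) :
    let γ : ℝ → E3 := fun u => f (u, 0)
    let σ : ℝ → E3 := fun u => γ u - ⟪γ u - γ 0, ν (0, 0)⟫ • ν (0, 0)
    ⟪pu (pu f) (0, 0), ν (0, 0)⟫ = 0 ∧
      ‖deriv (deriv σ) 0‖ = ‖deriv (deriv γ) 0‖ ∧
      |det3 (deriv (deriv σ) 0) (deriv (deriv (deriv σ)) 0) (ν (0, 0))| /
          ‖deriv (deriv σ) 0‖ ^ ((5 : ℝ) / 2) =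
        |det3 (deriv (deriv γ) 0) (deriv (deriv (deriv γ)) 0) (ν (0, 0))| /
          ‖deriv (deriv γ) 0‖ ^ ((5 : ℝ) / 2) := by
  intro γ σ
  have hdf := contDiff_pu hf
  have hddf := contDiff_pu hdf
  have hdiff {g : ℝ × ℝ → E3} (hg : ContDiff ℝ (⊤ : ℕ∞) g) :
      Differentiable ℝ (fun u : ℝ => g (u, 0)) := fun u =>
    (hasDerivAt_comp_mk_zero (hg.differentiable (by simp)) u).differentiableAt
  have hγ₁ : deriv γ = fun u => pu f (u, 0) := deriv_comp_mk_zero hf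
  have hγ₂ : deriv (deriv γ) = fun u => pu (pu f) (u, 0) := by
    rw [hγ₁]
    exact deriv_comp_mk_zero hdf
  have horth : ⟪pu (pu f) (0, 0), ν (0, 0)⟫ = 0 := by
    have hcurve : Tendsto (fun u : ℝ => (u, (0 : ℝ))) (nhds 0) (nhds (0, 0)) :=
      (by fun_prop : Continuous fun u : ℝ => (u, (0 : ℝ))).tendsto 0
    have hzero : (fun u : ℝ => ⟪ν (u, 0), pu f (u, 0)⟫) =ᶠ[nhds 0] fun _ => 0 :=
      (hcurve.eventually hfrontal).mono fun u hu => hu.2.1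
    have hd := (hasDerivAt_comp_mk_zero (hν.differentiable (by simp)) 0).inner ℝ
      (hasDerivAt_comp_mk_zero (hdf.differentiable (by simp)) 0)
    have h := hd.unique ((hasDerivAt_const (0 : ℝ) (0 : ℝ)).congr_of_eventuallyEq hzero)
    rw [hfu0, inner_zero_right, add_zero] at h
    rw [real_inner_comm, h]
  have hσ₁ : deriv σ = fun u => deriv γ u - ⟪deriv γ u, ν (0, 0)⟫ • ν (0, 0) :=
    deriv_sub_inner_smul (hdiff hf) _ _
  have hσ₂ : deriv (deriv σ) =
      fun u => deriv (deriv γ) u - ⟪deriv (deriv γ) u, ν (0, 0)⟫ • ν (0, 0) := by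
    rw [hσ₁]
    simpa using deriv_sub_inner_smul (hγ₁ ▸ hdiff hdf : Differentiable ℝ (deriv γ)) 0 (ν (0, 0))
  have hσ₃ : deriv (deriv (deriv σ)) = fun u => deriv (deriv (deriv γ)) u -
      ⟪deriv (deriv (deriv γ)) u, ν (0, 0)⟫ • ν (0, 0) := by
    rw [hσ₂]
    simpa using deriv_sub_inner_smul
      (hγ₂ ▸ hdiff hddf : Differentiable ℝ (deriv (deriv γ))) 0 (ν (0, 0))
  have hdet : det3 (deriv (deriv σ) 0) (deriv (deriv (deriv σ)) 0) (ν (0, 0)) =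
      det3 (deriv (deriv γ) 0) (deriv (deriv (deriv γ)) 0) (ν (0, 0)) := by
    rw [hσ₃, hσ₂]
    exact det3_sub_smul_right _ _ _ _ _
  have hnorm : ‖deriv (deriv σ) 0‖ = ‖deriv (deriv γ) 0‖ := by
    simp only [hσ₂, hγ₂, horth, zero_smul, sub_zero]
  exact ⟨horth, hnorm, by rw [hdet, hnorm]⟩
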